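/- Let δ⁰ = (δ⁰₁, δ⁰₂, δ⁰₃) and δ¹ = (δ¹₁, δ¹₂, δ¹₃) be smooth ℝ³-valued functions on the two-dimensional torus 𝕋² satisfying the compatibility condition ∫_{𝕋²} (δ¹₃ - δ⁰₃) dx_h = 0. Then there exists a smooth vector field w = (w₁, w₂, w₃) : 𝕋² × [0,1] → ℝ³ which is divergence free (∂₁w₁ + ∂₂w₂ + ∂_z w₃ = 0), and satisfies the boundary conditions w(x_h, 0) = δ⁰(x_h), w₃(x_h, 1) = δ¹₃(x_h), and ∂_z w₁(x_h,1) = δ¹₁(x_h), ∂_z w₂(x_h,1) = δ¹₂(x_h) for all x_h ∈ 𝕋². (Construction underlying the stopping Lemma: a divergence-free lifting of mixed Dirichlet/Neumann boundary data.) -/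

import Mathlib

open Real MeasureTheory intervalIntegral

noncomputable def DD1 (f : ℝ × ℝ → ℝ) (p : ℝ × ℝ) : ℝ := fderiv ℝ f p (1, 0)
noncomputable def DD2 (f : ℝ × ℝ → ℝ) (p : ℝ × ℝ) : ℝ := fderiv ℝ f p (0, 1)
noncomputable def PP (f : ℝ × ℝ → ℝ) (p : ℝ × ℝ) : ℝ := ∫ s in (0:ℝ)..p.2, f (p.1, s)

def Sm (f : ℝ × ℝ → ℝ) : Prop := ContDiff ℝ (⊤ : ℕ∞) f
def Per (f : ℝ × ℝ → ℝ) : Prop := ∀ x y : ℝ,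
  f (x + 2 * Real.pi, y) = f (x, y) ∧ f (x, y + 2 * Real.pi) = f (x, y)

lemma Sm.diff {f : ℝ × ℝ → ℝ} (h : Sm f) : Differentiable ℝ f := by
  unfold Sm at h
  exact h.differentiable (by simp)

lemma Sm.cont {f : ℝ × ℝ → ℝ} (h : Sm f) : Continuous f := h.diff.continuous

lemma Sm.DD1 {f : ℝ × ℝ → ℝ} (h : Sm f) : Sm (DD1 f) := by
  unfold Sm at *
  exact (h.fderiv_right (m := (⊤ : ℕ∞)) (by simp)).clm_apply contDiff_const

lemma Sm.DD2 {f : ℝ × ℝ → ℝ} (h : Sm f) : Sm (DD2 f) := by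
  unfold Sm at *
  exact (h.fderiv_right (m := (⊤ : ℕ∞)) (by simp)).clm_apply contDiff_const

lemma Sm.hd1 {f : ℝ × ℝ → ℝ} (h : Sm f) (x y : ℝ) :
    HasDerivAt (fun s => f (s, y)) (_root_.DD1 f (x, y)) x := by
  have h1 : HasDerivAt (fun s : ℝ => (s, y)) ((1 : ℝ), (0 : ℝ)) x :=
    (hasDerivAt_id x).prodMk (hasDerivAt_const x y)
  exact (h.diff (x, y)).hasFDerivAt.comp_hasDerivAt x h1

lemma Sm.hd2 {f : ℝ × ℝ → ℝ} (h : Sm f) (x y : ℝ) :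
    HasDerivAt (fun s => f (x, s)) (_root_.DD2 f (x, y)) y := by
  have h1 : HasDerivAt (fun s : ℝ => (x, s)) ((0 : ℝ), (1 : ℝ)) y :=
    (hasDerivAt_const y x).prodMk (hasDerivAt_id y)
  exact (h.diff (x, y)).hasFDerivAt.comp_hasDerivAt y h1

lemma Per.fd {f : ℝ × ℝ → ℝ} (h : Per f) (x y : ℝ) :
    fderiv ℝ f (x + 2 * Real.pi, y) = fderiv ℝ f (x, y) ∧
    fderiv ℝ f (x, y + 2 * Real.pi) = fderiv ℝ f (x, y) := by
  constructor
  · have e : (fun p : ℝ × ℝ => f (p + (2 * Real.pi, 0))) = f := by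
      ext ⟨a, b⟩
      simpa using (h a b).1
    have := fderiv_comp_add_right (𝕜 := ℝ) (f := f) (x := (x, y)) ((2 * Real.pi, 0) : ℝ × ℝ)
    rw [e] at this
    simpa using this.symm
  · have e : (fun p : ℝ × ℝ => f (p + (0, 2 * Real.pi))) = f := by
      ext ⟨a, b⟩
      simpa using (h a b).2
    have := fderiv_comp_add_right (𝕜 := ℝ) (f := f) (x := (x, y)) ((0, 2 * Real.pi) : ℝ × ℝ)
    rw [e] at this
    simpa using this.symm

lemma Per.DD1 {f : ℝ × ℝ → ℝ} (h : Per f) : Per (DD1 f) := fun x y => by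
  simp [_root_.DD1, (h.fd x y).1, (h.fd x y).2]

lemma Per.DD2 {f : ℝ × ℝ → ℝ} (h : Per f) : Per (DD2 f) := fun x y => by
  simp [_root_.DD2, (h.fd x y).1, (h.fd x y).2]

lemma cont_PP {f : ℝ × ℝ → ℝ} (h : Continuous f) : Continuous (PP f) := by
  unfold PP
  exact intervalIntegral.continuous_parametric_intervalIntegral_of_continuous
    (f := fun (p : ℝ × ℝ) s => f (p.1, s)) (by fun_prop) continuous_snd

lemma PP_d2 {f : ℝ × ℝ → ℝ} (h : Continuous f) (x y : ℝ) :
    HasDerivAt (fun s => PP f (x, s)) (f (x, y)) y := by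
  have hc : Continuous (fun s => f (x, s)) := by fun_prop
  exact intervalIntegral.integral_hasDerivAt_right (hc.intervalIntegrable _ _)
    (hc.stronglyMeasurableAtFilter _ _) hc.continuousAt

lemma PP_d1 {f : ℝ × ℝ → ℝ} (h : Sm f) (x y : ℝ) :
    HasDerivAt (fun s => PP f (s, y)) (PP (DD1 f) (x, y)) x := by
  have hf := h.cont
  have hd := h.DD1.cont
  obtain ⟨C, hC⟩ := ((isCompact_closedBall x 1).prod (isCompact_uIcc (a := (0:ℝ)) (b := y))
    ).exists_bound_of_continuousOn hd.continuousOn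
  refine (intervalIntegral.hasDerivAt_integral_of_dominated_loc_of_deriv_le (𝕜 := ℝ)
    (μ := volume) (a := 0) (b := y) (F := fun s t => f (s, t))
    (F' := fun s t => DD1 f (s, t)) (bound := fun _ => C)
    (Metric.closedBall_mem_nhds x one_pos) ?_ ?_ ?_ ?_ ?_ ?_).2
  · refine Filter.Eventually.of_forall fun s => ?_
    have : Continuous (fun t => f (s, t)) := by fun_prop
    exact this.aestronglyMeasurable
  · have : Continuous (fun t => f (x, t)) := by fun_prop
    exact this.intervalIntegrable _ _
  · have : Continuous (fun t => DD1 f (x, t)) := by fun_prop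
    exact this.aestronglyMeasurable
  · refine Filter.Eventually.of_forall fun t ht s hs => hC (s, t) ⟨hs, Set.uIoc_subset_uIcc ht⟩
  · exact intervalIntegrable_const
  · exact Filter.Eventually.of_forall fun t ht s hs => h.hd1 s t

lemma PP_fd {f : ℝ × ℝ → ℝ} (h : Sm f) (p : ℝ × ℝ) :
    HasFDerivAt (PP f) (PP (DD1 f) p • ContinuousLinearMap.fst ℝ ℝ ℝ
      + f p • ContinuousLinearMap.snd ℝ ℝ ℝ) p := by
  have hf := h.cont
  have hc := cont_PP h.DD1.cont
  have := (hasStrictFDerivAt_uncurry_coprod (𝕜 := ℝ) (u := p) (f := fun x y => PP f (x, y))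
    (f₁ := fun x y => ContinuousLinearMap.toSpanSingleton ℝ (PP (DD1 f) (x, y)))
    (f₂ := fun x y => ContinuousLinearMap.toSpanSingleton ℝ (f (x, y)))
    (Filter.Eventually.of_forall fun v => (PP_d1 h v.1 v.2).hasFDerivAt)
    (Filter.Eventually.of_forall fun v => (PP_d2 hf v.1 v.2).hasFDerivAt)
    (((ContinuousLinearMap.toSpanSingletonCLE (𝕜 := ℝ) (E := ℝ)).continuous.comp hc).continuousAt)
    (((ContinuousLinearMap.toSpanSingletonCLE (𝕜 := ℝ) (E := ℝ)).continuous.comp hf).continuousAt)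
    ).hasFDerivAt
  refine HasFDerivAt.congr_fderiv (f := PP f) this ?_
  ext <;> simp [Function.HasUncurry.uncurry]

lemma Sm.PP {f : ℝ × ℝ → ℝ} (h : Sm f) : Sm (PP f) := by
  have key : ∀ n : ℕ, ∀ f : ℝ × ℝ → ℝ, Sm f → ContDiff ℝ n (_root_.PP f) := by
    intro n
    induction n with
    | zero => intro f hf; exact contDiff_zero.2 (cont_PP hf.cont)
    | succ n ih =>
      intro f hf
      have e : fderiv ℝ (_root_.PP f) = fun p => _root_.PP (_root_.DD1 f) p •
          ContinuousLinearMap.fst ℝ ℝ ℝ + f p • ContinuousLinearMap.snd ℝ ℝ ℝ :=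
        funext fun p => (PP_fd hf p).fderiv
      push_cast
      refine contDiff_succ_iff_fderiv.2 ⟨fun p => (PP_fd hf p).differentiableAt, by simp, ?_⟩
      rw [e]
      have h2 : ContDiff ℝ n f := ContDiff.of_le hf (by exact_mod_cast le_top)
      exact ((ih _ hf.DD1).smul contDiff_const).add (h2.smul contDiff_const)
  exact contDiff_infty.2 fun n => key n f h

lemma prim_per {h : ℝ → ℝ} (hc : Continuous h) (hp : Function.Periodic h (2 * Real.pi)) (y : ℝ) :
    ∫ s in (0:ℝ)..(y + 2 * Real.pi), h s =
      (∫ s in (0:ℝ)..y, h s) + ∫ s in (0:ℝ)..(2 * Real.pi), h s := by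
  have e := hp.intervalIntegral_add_eq y 0
  rw [zero_add] at e
  rw [← e, intervalIntegral.integral_add_adjacent_intervals] <;>
    exact hc.intervalIntegrable _ _

lemma solve_div {g : ℝ × ℝ → ℝ} (hs : Sm g) (hp : Per g)
    (h0 : (∫ x in (0:ℝ)..(2 * Real.pi), ∫ y in (0:ℝ)..(2 * Real.pi), g (x, y)) = 0) :
    ∃ F1 F2 : ℝ × ℝ → ℝ, Sm F1 ∧ Sm F2 ∧ Per F1 ∧ Per F2 ∧ ∀ p, DD1 F1 p + DD2 F2 p = g p := by
  have hpi : (2 * Real.pi) ≠ 0 := by positivity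
  have hg := hs.cont
  set M : ℝ → ℝ := fun x => PP g (x, 2 * Real.pi) / (2 * Real.pi) with hM
  have sM : ContDiff ℝ (⊤ : ℕ∞) M := by
    have : ContDiff ℝ (⊤ : ℕ∞) (PP g) := hs.PP
    exact (this.comp (contDiff_id.prodMk contDiff_const)).div_const _
  have sN : Sm (fun p : ℝ × ℝ => M p.2) := sM.comp contDiff_snd
  have pM : Function.Periodic M (2 * Real.pi) := fun x => by
    simp only [hM, PP, (hp _ _).1]
  have iM : ∫ x in (0:ℝ)..(2 * Real.pi), M x = 0 := by
    simp only [hM, PP, intervalIntegral.integral_div, h0, zero_div]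
  have sPN : ContDiff ℝ (⊤ : ℕ∞) (PP (fun p : ℝ × ℝ => M p.2)) := sN.PP
  have s1 : Sm (fun p : ℝ × ℝ => PP (fun p : ℝ × ℝ => M p.2) (0, p.1)) :=
    sPN.comp (contDiff_const.prodMk contDiff_fst)
  have sPg : ContDiff ℝ (⊤ : ℕ∞) (PP g) := hs.PP
  have s2 : Sm (fun p : ℝ × ℝ => PP g p - p.2 * M p.1) :=
    sPg.sub (contDiff_snd.mul (sM.comp contDiff_fst))
  refine ⟨_, _, s1, s2, ?_, ?_, ?_⟩
  · intro x y
    refine ⟨?_, rfl⟩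
    simp only [PP]
    rw [prim_per sM.continuous pM, iM, add_zero]
  · intro x y
    constructor
    · have : M (x + 2 * Real.pi) = M x := pM x
      simp only [this]
      simp only [PP, (hp _ _).1]
    · simp only [PP]
      rw [prim_per (h := fun s => g (x, s)) (by fun_prop) (fun s => (hp x s).2)]
      have : (∫ s in (0:ℝ)..(2 * Real.pi), g (x, s)) = 2 * Real.pi * M x := by
        simp only [hM, PP]; field_simp
      rw [this]; ring
  · rintro ⟨x, y⟩
    have e1 := (s1.hd1 x y).unique (PP_d2 sN.cont 0 x)
    have e2 := (s2.hd2 x y).unique ((PP_d2 hg x y).sub ((hasDerivAt_id y).mul_const (M x)))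
    rw [e1, e2]; simp

/-- Construction underlying the stopping Lemma: a smooth divergence-free lifting on
`𝕋² × [0,1]` of mixed Dirichlet (at `z = 0`) / Neumann-and-flux (at `z = 1`) boundary data,
under the compatibility condition `∫_{𝕋²} (δ¹₃ - δ⁰₃) = 0`.  Functions on the torus
`𝕋² = (ℝ/2πℤ)²` are represented by `2π`-periodic smooth functions on `ℝ²`. -/
theorem divergence_free_lifting
    (d01 d02 d03 d11 d12 d13 : ℝ → ℝ → ℝ)
    (hsmooth : ∀ d ∈ [d01, d02, d03, d11, d12, d13],
      ContDiff ℝ (⊤ : ℕ∞) (fun p : ℝ × ℝ => d p.1 p.2))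
    (hper : ∀ d ∈ [d01, d02, d03, d11, d12, d13], ∀ x1 x2 : ℝ,
      d (x1 + 2 * Real.pi) x2 = d x1 x2 ∧ d x1 (x2 + 2 * Real.pi) = d x1 x2)
    (hcompat : (∫ x1 in (0 : ℝ)..(2 * Real.pi), ∫ x2 in (0 : ℝ)..(2 * Real.pi),
        (d13 x1 x2 - d03 x1 x2)) = 0) :
    ∃ w1 w2 w3 : ℝ → ℝ → ℝ → ℝ,
      (∀ w ∈ [w1, w2, w3],
        ContDiff ℝ (⊤ : ℕ∞) (fun p : ℝ × ℝ × ℝ => w p.1 p.2.1 p.2.2) ∧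
        ∀ x1 x2 z : ℝ,
          w (x1 + 2 * Real.pi) x2 z = w x1 x2 z ∧ w x1 (x2 + 2 * Real.pi) z = w x1 x2 z) ∧
      (∀ x1 x2 : ℝ, ∀ z ∈ Set.Icc (0 : ℝ) 1,
        deriv (fun s => w1 s x2 z) x1 + deriv (fun s => w2 x1 s z) x2 +
          deriv (fun s => w3 x1 x2 s) z = 0) ∧
      (∀ x1 x2 : ℝ,
        w1 x1 x2 0 = d01 x1 x2 ∧ w2 x1 x2 0 = d02 x1 x2 ∧ w3 x1 x2 0 = d03 x1 x2 ∧
        w3 x1 x2 1 = d13 x1 x2 ∧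
        deriv (fun s => w1 x1 x2 s) 1 = d11 x1 x2 ∧
        deriv (fun s => w2 x1 x2 s) 1 = d12 x1 x2) := by
  let T : (ℝ → ℝ → ℝ) → ℝ × ℝ → ℝ := fun d p => d p.1 p.2
  have S : ∀ d ∈ [d01, d02, d03, d11, d12, d13], Sm (T d) := hsmooth
  have Q : ∀ d ∈ [d01, d02, d03, d11, d12, d13], Per (T d) := hper
  have s01 := S d01 (by simp)
  have s02 := S d02 (by simp)
  have s03 := S d03 (by simp)
  have s11 := S d11 (by simp)
  have s12 := S d12 (by simp)
  have s13 := S d13 (by simp)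
  have q01 := Q d01 (by simp)
  have q02 := Q d02 (by simp)
  have q03 := Q d03 (by simp)
  have q11 := Q d11 (by simp)
  have q12 := Q d12 (by simp)
  have q13 := Q d13 (by simp)
  obtain ⟨F1, F2, sF1, sF2, qF1, qF2, hF⟩ := solve_div (g := fun p => T d13 p - T d03 p)
    (ContDiff.sub s13 s03)
    (fun x y => by simp only [(q13 x y).1, (q03 x y).1, (q13 x y).2, (q03 x y).2, and_self])
    hcompat
  set e0 : ℝ × ℝ → ℝ := fun p => DD1 (T d01) p + DD2 (T d02) p with he0
  set e1 : ℝ × ℝ → ℝ := fun p => DD1 (T d11) p + DD2 (T d12) p with he1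
  have se0 : Sm e0 := ContDiff.add s01.DD1 s02.DD2
  have se1 : Sm e1 := ContDiff.add s11.DD1 s12.DD2
  have qe0 : Per e0 := fun x y => by
    simp only [he0, (q01.DD1 x y).1, (q01.DD1 x y).2, (q02.DD2 x y).1, (q02.DD2 x y).2, and_self]
  have qe1 : Per e1 := fun x y => by
    simp only [he1, (q11.DD1 x y).1, (q11.DD1 x y).2, (q12.DD2 x y).1, (q12.DD2 x y).2, and_self]
  set a : ℝ → ℝ := fun z => (1 - z) ^ 2 * (1 - 4 * z) with ha
  set b : ℝ → ℝ := fun z => z * (z - 1) ^ 2 + z ^ 2 * (z - 1) with hb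
  set c : ℝ → ℝ := fun z => 3 * z - 3 / 2 * z ^ 2 with hc
  set A : ℝ → ℝ := fun z => z * (1 - z) ^ 3 with hA
  set B : ℝ → ℝ := fun z => z ^ 2 * (z - 1) ^ 2 / 2 with hB
  set C : ℝ → ℝ := fun z => 3 / 2 * z ^ 2 - 1 / 2 * z ^ 3 with hC
  have ca : ContDiff ℝ (⊤ : ℕ∞) a := by fun_prop
  have cb : ContDiff ℝ (⊤ : ℕ∞) b := by fun_prop
  have cc : ContDiff ℝ (⊤ : ℕ∞) c := by fun_prop
  have cA : ContDiff ℝ (⊤ : ℕ∞) A := by fun_prop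
  have cB : ContDiff ℝ (⊤ : ℕ∞) B := by fun_prop
  have cC : ContDiff ℝ (⊤ : ℕ∞) C := by fun_prop
  have id1 : ∀ z : ℝ, HasDerivAt (fun z : ℝ => 1 - z) (-1) z := fun z => by
    simpa using (hasDerivAt_id z).const_sub 1
  have id2 : ∀ z : ℝ, HasDerivAt (fun z : ℝ => z - 1) 1 z := fun z => by
    simpa using (hasDerivAt_id z).sub_const 1
  have dA : ∀ z, HasDerivAt A (a z) z := fun z => by
    refine ((hasDerivAt_id z).mul ((id1 z).pow 3)).congr_deriv ?_
    simp [ha]; ring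
  have dB : ∀ z, HasDerivAt B (b z) z := fun z => by
    refine ((((hasDerivAt_id z).pow 2).mul ((id2 z).pow 2)).div_const 2).congr_deriv ?_
    simp [hb]; ring
  have dC : ∀ z, HasDerivAt C (c z) z := fun z => by
    refine ((((hasDerivAt_id z).pow 2).const_mul (3/2)).sub
      (((hasDerivAt_id z).pow 3).const_mul (1/2))).congr_deriv ?_
    simp [hc]; ring
  have da : HasDerivAt a 0 1 := by
    refine (((id1 1).pow 2).mul (((hasDerivAt_id (1:ℝ)).const_mul 4).const_sub 1)).congr_deriv ?_
    simp
  have db : HasDerivAt b 1 1 := by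
    refine (((hasDerivAt_id (1:ℝ)).mul ((id2 1).pow 2)).add
      (((hasDerivAt_id (1:ℝ)).pow 2).mul (id2 1))).congr_deriv ?_
    simp
  have dc : HasDerivAt c 0 1 := by
    refine (((hasDerivAt_id (1:ℝ)).const_mul 3).sub
      (((hasDerivAt_id (1:ℝ)).pow 2).const_mul (3/2))).congr_deriv ?_
    norm_num
  have pr : ContDiff ℝ (⊤ : ℕ∞) (fun p : ℝ × ℝ × ℝ => (p.1, p.2.1)) := by fun_prop
  have pz : ContDiff ℝ (⊤ : ℕ∞) (fun p : ℝ × ℝ × ℝ => p.2.2) := by fun_prop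
  have L : ∀ {u : ℝ → ℝ} {f : ℝ × ℝ → ℝ}, ContDiff ℝ (⊤ : ℕ∞) u → Sm f →
      ContDiff ℝ (⊤ : ℕ∞) (fun p : ℝ × ℝ × ℝ => u p.2.2 * f (p.1, p.2.1)) :=
    fun hu hf => (hu.comp pz).mul (ContDiff.comp hf pr)
  have L0 : ContDiff ℝ (⊤ : ℕ∞) (fun p : ℝ × ℝ × ℝ => T d03 (p.1, p.2.1)) :=
    ContDiff.comp s03 pr
  refine ⟨fun x y z => a z * T d01 (x, y) + b z * T d11 (x, y) - c z * F1 (x, y),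
    fun x y z => a z * T d02 (x, y) + b z * T d12 (x, y) - c z * F2 (x, y),
    fun x y z => T d03 (x, y) - A z * e0 (x, y) - B z * e1 (x, y)
      + C z * (T d13 (x, y) - T d03 (x, y)), ?_, ?_, ?_⟩
  · intro w hw
    simp only [List.mem_cons, List.not_mem_nil, or_false] at hw
    rcases hw with rfl | rfl | rfl
    · refine ⟨((L ca s01).add (L cb s11)).sub (L cc sF1), fun x y z => ?_⟩
      simp only [(q01 x y).1, (q11 x y).1, (qF1 x y).1, (q01 x y).2, (q11 x y).2, (qF1 x y).2,
        and_self]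
    · refine ⟨((L ca s02).add (L cb s12)).sub (L cc sF2), fun x y z => ?_⟩
      simp only [(q02 x y).1, (q12 x y).1, (qF2 x y).1, (q02 x y).2, (q12 x y).2, (qF2 x y).2,
        and_self]
    · refine ⟨((L0.sub (L cA se0)).sub (L cB se1)).add (L cC (ContDiff.sub s13 s03)),
        fun x y z => ?_⟩
      simp only [(q03 x y).1, (q13 x y).1, (qe0 x y).1, (qe1 x y).1, (q03 x y).2, (q13 x y).2,
        (qe0 x y).2, (qe1 x y).2, and_self]
  · intro x y z _
    have h1 := ((((s01.hd1 x y).const_mul (a z)).add ((s11.hd1 x y).const_mul (b z))).sub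
      ((sF1.hd1 x y).const_mul (c z))).deriv
    have h2 := ((((s02.hd2 x y).const_mul (a z)).add ((s12.hd2 x y).const_mul (b z))).sub
      ((sF2.hd2 x y).const_mul (c z))).deriv
    have h3 := (((((dA z).mul_const (e0 (x, y))).const_sub (T d03 (x, y))).sub
      ((dB z).mul_const (e1 (x, y)))).add
      ((dC z).mul_const (T d13 (x, y) - T d03 (x, y)))).deriv
    refine (congrArg₂ (· + ·) (congrArg₂ (· + ·) h1 h2) h3).trans ?_
    have := hF (x, y)
    simp only [he0, he1] at this ⊢
    rw [← this]; ring
  · intro x y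
    refine ⟨?_, ?_, ?_, ?_, ?_, ?_⟩
    · simp [ha, hb, hc, T]
    · simp [ha, hb, hc, T]
    · simp [hA, hB, hC, T]
    · simp only [hA, hB, hC, T]; ring
    · refine (((da.mul_const (T d01 (x, y))).add (db.mul_const (T d11 (x, y)))).sub
        (dc.mul_const (F1 (x, y)))).deriv.trans ?_
      simp [T]
    · refine (((da.mul_const (T d02 (x, y))).add (db.mul_const (T d12 (x, y)))).sub
        (dc.mul_const (F2 (x, y)))).deriv.trans ?_
      simp [T]
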